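/- Mixing with a constant classifier restores feasibility: suppose a randomized classifier π satisfies |E_X[(γ̂_k(X) − γ̂_{k'}(X)) π(X,y)]| ≤ min(1, α + ε) for all k, k' ∈ I (where γ̂_k has mean 1). Let β = min(1 − α, ε/(α+ε)) (with 0/0 := 0) and define π̃(x,·) = (1−β)π(x,·) + β e_1, where e_1 is a point mass on a fixed class. Then |E_X[(γ̂_k(X) − γ̂_{k'}(X)) π̃(X,y)]| ≤ α for all k, k' ∈ I, and E_X[∑_{y'} |π̃(X,y') − π(X,y')|] ≤ 2β. -/

import Mathlib

open MeasureTheory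

/-- Mixing with a constant classifier restores feasibility: mixing `π` with weight
`β = min(1-α, ε/(α+ε))` onto a fixed class yields a classifier `π̃` satisfying the
fairness constraints with tolerance `α`, while moving at most `2β` in `L¹`. -/
theorem mixing_restores_feasibility
    {𝒳 𝒴 ι : Type*} [MeasurableSpace 𝒳] [Fintype 𝒴] [DecidableEq 𝒴] [Fintype ι]
    (μ : Measure 𝒳) [IsProbabilityMeasure μ]
    (γhat : ι → 𝒳 → ℝ)
    (hγhat0 : ∀ k x, 0 ≤ γhat k x)
    (hγhatint : ∀ k, Integrable (γhat k) μ)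
    (hγhatmean : ∀ k, ∫ x, γhat k x ∂μ = 1)
    (I : Finset ι)
    (π : 𝒳 → 𝒴 → ℝ) (hπsimplex : ∀ x, (∀ y', 0 ≤ π x y') ∧ ∑ y', π x y' = 1)
    (hπint : ∀ k y', Integrable (fun x => γhat k x * π x y') μ)
    (α ε : ℝ) (hα : α ∈ Set.Icc (0:ℝ) 1) (hε : 0 ≤ ε)
    (y : 𝒴)
    (hfeas : ∀ k ∈ I, ∀ k' ∈ I,
      |∫ x, (γhat k x - γhat k' x) * π x y ∂μ| ≤ min 1 (α + ε))
    (y₁ : 𝒴) (β : ℝ) (hβ : β = min (1 - α) (ε / (α + ε)))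
    (πtilde : 𝒳 → 𝒴 → ℝ)
    (hπtilde : ∀ x y', πtilde x y'
      = (1 - β) * π x y' + β * (if y' = y₁ then 1 else 0)) :
    (∀ k ∈ I, ∀ k' ∈ I,
      |∫ x, (γhat k x - γhat k' x) * πtilde x y ∂μ| ≤ α) ∧
    ∫ x, ∑ y', |πtilde x y' - π x y'| ∂μ ≤ 2 * β := by
  have hα0 := hα.1
  have hα1 := hα.2
  have hβ0 : 0 ≤ β := by
    rw [hβ]
    exact le_min (by linarith) (by positivity)
  have hβ1 : β ≤ 1 := by
    have := min_le_left (1 - α) (ε / (α + ε))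
    rw [← hβ] at this
    linarith
  have key : (1 - β) * min 1 (α + ε) ≤ α := by
    rcases min_choice (1 - α) (ε / (α + ε)) with h | h
    · rw [hβ, h]
      have := min_le_left 1 (α + ε)
      nlinarith
    · have h2 := min_le_right 1 (α + ε)
      have h3 : (1 - β) * min 1 (α + ε) ≤ (1 - β) * (α + ε) :=
        mul_le_mul_of_nonneg_left h2 (by linarith)
      refine h3.trans ?_
      rw [hβ, h]
      rcases (add_nonneg hα0 hε).eq_or_lt with h0 | h0
      · rw [← h0]; simpa using hα0
      · have : (1 - ε / (α + ε)) * (α + ε) = α := by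
          field_simp
          ring
        exact this.le
  constructor
  · intro k hk k' hk'
    have hi : Integrable (fun x => (γhat k x - γhat k' x) * π x y) μ := by
      have := (hπint k y).sub (hπint k' y)
      refine this.congr (Filter.Eventually.of_forall fun x => ?_)
      simp only [Pi.sub_apply]
      ring
    have hj : Integrable (fun x => γhat k x - γhat k' x) μ :=
      (hγhatint k).sub (hγhatint k')
    have e : ∫ x, (γhat k x - γhat k' x) * πtilde x y ∂μ
        = (1 - β) * ∫ x, (γhat k x - γhat k' x) * π x y ∂μ := by
      have e1 : ∀ x, (γhat k x - γhat k' x) * πtilde x y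
          = (1 - β) * ((γhat k x - γhat k' x) * π x y)
            + (β * (if y = y₁ then 1 else 0)) * (γhat k x - γhat k' x) := by
        intro x
        rw [hπtilde]
        ring
      simp_rw [e1]
      rw [integral_add (hi.const_mul _) (hj.const_mul _), integral_const_mul,
        integral_const_mul, integral_sub (hγhatint k) (hγhatint k'), hγhatmean, hγhatmean]
      ring
    rw [e, abs_mul, abs_of_nonneg (by linarith : 0 ≤ 1 - β)]
    exact (mul_le_mul_of_nonneg_left (hfeas k hk k' hk') (by linarith)).trans key
  · have hp : ∀ x, ∑ y', |πtilde x y' - π x y'| ≤ 2 * β := by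
      intro x
      obtain ⟨h0, h1⟩ := hπsimplex x
      have : ∀ y', |πtilde x y' - π x y'| ≤ β * (if y' = y₁ then 1 else 0) + β * π x y' := by
        intro y'
        have hi : (0:ℝ) ≤ β * (if y' = y₁ then 1 else 0) := by
          split_ifs <;> simp [hβ0]
        have hq := mul_nonneg hβ0 (h0 y')
        rw [hπtilde, abs_le]
        constructor <;> linarith
      refine (Finset.sum_le_sum fun y' _ => this y').trans ?_
      rw [Finset.sum_add_distrib, ← Finset.mul_sum, ← Finset.mul_sum, h1]
      simp
      linarith
    have := integral_mono_of_nonneg (μ := μ)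
      (Filter.Eventually.of_forall fun x => Finset.sum_nonneg fun y' _ => abs_nonneg _)
      (integrable_const (2 * β)) (Filter.Eventually.of_forall hp)
    simpa using this
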